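/- arXiv:2301.07664 — 2 statements merged into one kernel-verified Lean document; each statement's English description precedes it below -/
import Mathlib

section
/- Let A be a commutative ring and n ∈ ℕ. On the set of units of A[Y]/(Y^n), the operation t₁ * t₂ := t₁(t₂(Y)·Y) · t₂(Y) (substitution product) defines a group structure, with identity the constant polynomial 1. -/
open Polynomial in
theorem stmt8 {A : Type*} [CommRing A] (n : ℕ) :
    ∃ star : (A[X] ⧸ Ideal.span {(X : A[X]) ^ n}) →
             (A[X] ⧸ Ideal.span {(X : A[X]) ^ n}) →
             (A[X] ⧸ Ideal.span {(X : A[X]) ^ n}),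
      (∀ t₁ t₂ : A[X],
          star (Ideal.Quotient.mk (Ideal.span {(X : A[X]) ^ n}) t₁)
               (Ideal.Quotient.mk (Ideal.span {(X : A[X]) ^ n}) t₂) =
            Ideal.Quotient.mk (Ideal.span {(X : A[X]) ^ n}) (t₁.comp (t₂ * X) * t₂)) ∧
      (∀ a b, IsUnit a → IsUnit b → IsUnit (star a b)) ∧
      (∀ a b c, IsUnit a → IsUnit b → IsUnit c → star (star a b) c = star a (star b c)) ∧
      (∀ a, IsUnit a → star a 1 = a ∧ star 1 a = a) ∧
      (∀ a, IsUnit a → ∃ b, IsUnit b ∧ star a b = 1 ∧ star b a = 1) := by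
  let I : Ideal A[X] := Ideal.span {(X : A[X]) ^ n}
  let x : A[X] ⧸ I := Ideal.Quotient.mkₐ A I X
  have hx : x ^ n = 0 := by
    change (Ideal.Quotient.mkₐ A I X) ^ n = 0
    rw [← map_pow]
    exact Ideal.Quotient.eq_zero_iff_mem.2 (Ideal.subset_span rfl)
  have key : ∀ b : A[X] ⧸ I, ∃ f : (A[X] ⧸ I) →ₐ[A] (A[X] ⧸ I), f x = b * x := by
    intro b
    refine ⟨Ideal.Quotient.liftₐ I (aeval (b * x)) ?_, ?_⟩
    · intro p hp
      obtain ⟨q, rfl⟩ := Ideal.mem_span_singleton.1 hp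
      simp [mul_pow, hx]
    · exact aeval_X (b * x)
  choose φ hφ using key
  have hext : ∀ f g : (A[X] ⧸ I) →ₐ[A] (A[X] ⧸ I), f x = g x → f = g := by
    intro f g h
    apply Ideal.Quotient.algHom_ext
    exact Polynomial.algHom_ext h
  have happ : ∀ (f : (A[X] ⧸ I) →ₐ[A] (A[X] ⧸ I)) (p : A[X]),
      f (Ideal.Quotient.mkₐ A I p) = aeval (f x) p := by
    intro f p
    have : f.comp (Ideal.Quotient.mkₐ A I) = aeval (f x) := Polynomial.algHom_ext (by simp [x])
    exact DFunLike.congr_fun this p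
  have h1 : ∀ q, φ 1 q = q := by
    intro q
    have : φ 1 = AlgHom.id A _ := hext _ _ (by simp [hφ])
    rw [this]; rfl
  have hU : ∀ a b, IsUnit a → IsUnit b → IsUnit (φ b a * b) :=
    fun a b ha hb => (ha.map (φ b)).mul hb
  have hassoc : ∀ a b c, φ c (φ b a * b) * c = φ (φ c b * c) a * (φ c b * c) := by
    intro a b c
    have : (φ c).comp (φ b) = φ (φ c b * c) := hext _ _ (by simp [hφ, mul_assoc])
    rw [← this, map_mul, mul_assoc]; rfl
  have hsurj : ∀ a, IsUnit a → Function.Surjective (φ a) := by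
    rintro a ⟨u, rfl⟩
    have dec : ∀ k : ℕ, ∀ q, ∃ s r, q = φ u s + (u * x) ^ k * r := by
      intro k
      induction k with
      | zero => intro q; exact ⟨0, q, by simp⟩
      | succ k ih =>
        intro q
        obtain ⟨s, r, rfl⟩ := ih q
        obtain ⟨p, rfl⟩ := Ideal.Quotient.mkₐ_surjective A I r
        have hp : Ideal.Quotient.mkₐ A I p
            = x * Ideal.Quotient.mkₐ A I p.divX + algebraMap A _ (p.coeff 0) := by
          conv_lhs => rw [← Polynomial.X_mul_divX_add p]
          rw [map_add, map_mul]; rfl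
        refine ⟨s + x ^ k * algebraMap A _ (p.coeff 0),
          (↑u⁻¹ : A[X] ⧸ I) * Ideal.Quotient.mkₐ A I p.divX, ?_⟩
        rw [hp, map_add, map_mul, map_pow, hφ, AlgHom.commutes]
        have hu : (u : A[X] ⧸ I) * ↑u⁻¹ = 1 := u.mul_inv
        linear_combination (-(u * x) ^ k * x * Ideal.Quotient.mkₐ A I p.divX) * hu
    intro q
    obtain ⟨s, r, h⟩ := dec n q
    exact ⟨s, by rw [h, mul_pow, hx]; simp⟩
  have : Module.Finite A (A[X] ⧸ I) := (monic_X_pow n).finite_quotient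
  have hinj : ∀ a, IsUnit a → Function.Injective (φ a) := fun a ha =>
    OrzechProperty.injective_of_surjective_endomorphism (φ a).toLinearMap (hsurj a ha)
  have hleft : ∀ a, IsUnit a → ∃ b, IsUnit b ∧ φ a b * a = 1 := by
    intro a ha
    obtain ⟨u, rfl⟩ := ha
    obtain ⟨b, hb⟩ := hsurj u u.isUnit (↑u⁻¹)
    obtain ⟨c, hc⟩ := hsurj u u.isUnit u
    refine ⟨b, IsUnit.of_mul_eq_one c (hinj u u.isUnit ?_), ?_⟩
    · rw [map_mul, hb, hc, map_one, u.inv_mul]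
    · rw [hb, u.inv_mul]
  refine ⟨fun a b => φ b a * b, ?_, hU, fun a b c _ _ _ => hassoc a b c, ?_, ?_⟩
  · intro t₁ t₂
    rw [map_mul]
    refine congrArg (· * Ideal.Quotient.mk I t₂) ((happ (φ (Ideal.Quotient.mk I t₂)) t₁).trans ?_)
    rw [hφ]
    change aeval (Ideal.Quotient.mkₐ A I t₂ * Ideal.Quotient.mkₐ A I X) t₁
      = Ideal.Quotient.mkₐ A I _
    rw [← map_mul, aeval_algHom_apply, comp_eq_aeval]
  · intro a _
    exact ⟨by simp [h1], by simp⟩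
  · intro a ha
    obtain ⟨b, hb, hba⟩ := hleft a ha
    obtain ⟨c, hc, hcb⟩ := hleft b hb
    have hca : c = a := by
      have := hassoc c b a
      rw [hcb, hba, h1] at this
      simpa using this.symm
    subst hca
    exact ⟨b, hb, hcb, hba⟩
end

section
/- Let A be a commutative ring, 𝔭 a prime ideal of A with 𝔭 ≠ 𝔭², and q ∈ A[Y] a monic 𝔭-Eisenstein polynomial of degree e (all non-leading coefficients in 𝔭, constant term in 𝔭 ∖ 𝔭²). Let t ∈ A[Y] have t(0) a unit of A. Then the polynomial λ(t,q)(Z) := res_Y(q(Y), Z − t(Y)·Y) is again monic, 𝔭-Eisenstein, and of degree e in Z. -/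
/-- The resultant of `f` and `g`, regarded as polynomials of degree `m` and `n`
respectively, defined as the determinant of the Sylvester matrix: the first `n`
rows carry the coefficients of `f`, the remaining `m` rows those of `g`. -/
noncomputable def sylvesterResultant {A : Type*} [CommRing A]
    (f g : Polynomial A) (m n : ℕ) : A :=
  Matrix.det (Matrix.of fun i j : Fin (n + m) =>
    if (i : ℕ) < n then
      (if (i : ℕ) ≤ (j : ℕ) ∧ (j : ℕ) ≤ m + (i : ℕ) then f.coeff (m + (i : ℕ) - (j : ℕ)) else 0)
    else
      (if (i : ℕ) - n ≤ (j : ℕ) ∧ (j : ℕ) ≤ ((i : ℕ) - n) + n then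
        g.coeff (((i : ℕ) - n) + n - (j : ℕ)) else 0))

/-- `λ(t,q)(Z) = res_Y (q(Y), Z - t(Y)·Y)`: the resultant, eliminating `Y`, of
`q(Y)` and `Z - t(Y)·Y`, viewed as polynomials in `Y` over `A[Z]`.
The result is a polynomial in `Z`. -/
noncomputable def lambdaRes {A : Type*} [CommRing A] (t q : Polynomial A) : Polynomial A :=
  sylvesterResultant
    (q.map (Polynomial.C : A →+* Polynomial A))
    (Polynomial.C Polynomial.X - (t.map (Polynomial.C : A →+* Polynomial A)) * Polynomial.X)
    q.natDegree (t.natDegree + 1)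

open Polynomial in
theorem sylvesterResultant_eq {A : Type*} [CommRing A] (f g : Polynomial A) (m n : ℕ) :
    sylvesterResultant f g m n = resultant f g m n := by
  unfold sylvesterResultant resultant
  rw [← Matrix.det_transpose (sylvester f g m n),
    ← Matrix.det_submatrix_equiv_self ((finCongr (add_comm n m)).trans Fin.revPerm)
      (sylvester f g m n).transpose]
  congr 1
  ext i j
  obtain ⟨i', hi'⟩ : ∃ i', i' = ((finCongr (add_comm n m)).trans Fin.revPerm) i := ⟨_, rfl⟩
  have hv : (i' : ℕ) = m + n - (i + 1) := by simp [hi']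
  have hj : (((finCongr (add_comm n m)).trans Fin.revPerm) j : ℕ) = m + n - (j + 1) := by simp
  rw [Matrix.submatrix_apply, Matrix.transpose_apply, ← hi']
  clear hi'
  have hi2 := i.2
  have hj2 := j.2
  induction i' using Fin.addCases with
  | left k =>
    have hk := k.2
    simp only [Fin.val_castAdd] at hv
    simp only [sylvester, Matrix.of_apply, Fin.addCases_left, Set.mem_Icc, hj]
    rw [if_neg (by omega)]
    by_cases h : (i : ℕ) - n ≤ (j : ℕ) ∧ (j : ℕ) ≤ ((i : ℕ) - n) + n
    · rw [if_pos h, if_pos (by omega)]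
      congr 1
      omega
    · rw [if_neg h, if_neg (by omega)]
  | right k =>
    have hk := k.2
    simp only [Fin.val_natAdd] at hv
    simp only [sylvester, Matrix.of_apply, Fin.addCases_right, Set.mem_Icc, hj]
    rw [if_pos (by omega)]
    by_cases h : (i : ℕ) ≤ (j : ℕ) ∧ (j : ℕ) ≤ m + (i : ℕ)
    · rw [if_pos h, if_pos (by omega)]
      congr 1
      omega
    · rw [if_neg h, if_neg (by omega)]

open Polynomial in
theorem resultant_multiset_left {B : Type*} [CommRing B] [Nontrivial B] (s : Multiset B)
    (g : Polynomial B) (n : ℕ) (hn : g.natDegree ≤ n) :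
    resultant (s.map (fun r => X - C r)).prod g (Multiset.card s) n
      = (s.map (fun r => g.eval r)).prod := by
  induction s using Multiset.induction with
  | empty => simp
  | cons a s ih =>
    have h1 : (s.map (fun r => (X - C r : B[X]))).prod.natDegree = Multiset.card s :=
      natDegree_multiset_prod_X_sub_C_eq_card s
    have := resultant_mul_left (X - C a) (s.map (fun r => (X - C r : B[X]))).prod g n hn
    rw [h1, natDegree_X_sub_C, ih, resultant_X_sub_C_left _ _ _ hn] at this
    rw [Multiset.map_cons, Multiset.prod_cons, Multiset.map_cons, Multiset.prod_cons,
      Multiset.card_cons, add_comm, this]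

open Polynomial in
theorem lambdaRes_natDegree_aux {A : Type*} [CommRing A] (t : Polynomial A) :
    (C X - t.map (C : A →+* Polynomial A) * X).natDegree ≤ t.natDegree + 1 := by
  refine (natDegree_sub_le _ _).trans ?_
  simp only [natDegree_C, zero_le, sup_of_le_right]
  refine natDegree_mul_le.trans ?_
  exact add_le_add natDegree_map_le natDegree_X_le

open Polynomial in
theorem lambdaRes_map {A B : Type*} [CommRing A] [CommRing B] (φ : A →+* B)
    (t q : Polynomial A) :
    (lambdaRes t q).map φ = resultant ((q.map φ).map C)
      (C X - ((t.map φ).map C) * X) q.natDegree (t.natDegree + 1) := by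
  unfold lambdaRes
  rw [sylvesterResultant_eq, ← coe_mapRingHom, ← resultant_map_map]
  congr 1
  · rw [coe_mapRingHom, Polynomial.map_map, Polynomial.map_map, mapRingHom_comp_C]
  · simp [Polynomial.map_map, mapRingHom_comp_C]

open Polynomial in
theorem lambdaRes_monic {A : Type*} [CommRing A] [Nontrivial A]
    (t q : Polynomial A) (hq : q.Monic) :
    (lambdaRes t q).Monic ∧ (lambdaRes t q).natDegree = q.natDegree := by
  obtain ⟨S, _, _, _, _, _, hS⟩ := hq.exists_splits_map
  have hinj : Function.Injective (algebraMap A S) := FaithfulSMul.algebraMap_injective A S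
  obtain ⟨m, hm⟩ := splits_iff_exists_multiset.mp hS
  rw [(hq.map _).leadingCoeff, C_1, one_mul] at hm
  have hc : q.natDegree = Multiset.card m := by
    rw [← hq.natDegree_map (algebraMap A S), hm]
    exact natDegree_multiset_prod_X_sub_C_eq_card m
  have key : (lambdaRes t q).map (algebraMap A S) =
      (m.map (fun r => (X - C ((t.map (algebraMap A S)).eval r * r) : S[X]))).prod := by
    rw [lambdaRes_map, hm, hc]
    have hh : ((m.map (fun r => (X - C r : S[X]))).prod).map (C : S →+* S[X])
        = ((m.map C).map (fun r => (X - C r : S[X][X]))).prod := by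
      rw [Polynomial.map_multiset_prod, Multiset.map_map, Multiset.map_map]
      simp
    have hd : (C X - (t.map (algebraMap A S)).map (C : S →+* S[X]) * X).natDegree
        ≤ t.natDegree + 1 :=
      (lambdaRes_natDegree_aux _).trans (by simpa using natDegree_map_le)
    have := resultant_multiset_left (m.map (C : S →+* S[X])) _ _ hd
    rw [Multiset.card_map] at this
    rw [hh, this, Multiset.map_map]
    congr 1
    apply Multiset.map_congr rfl
    intro r _
    simp [eval_map, eval₂_at_apply]
  have key2 : (lambdaRes t q).map (algebraMap A S) =
      ((m.map (fun r => (t.map (algebraMap A S)).eval r * r)).map (fun r => X - C r)).prod := by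
    rw [key, Multiset.map_map]; rfl
  refine ⟨monic_of_injective hinj ?_, ?_⟩
  · rw [key2]
    exact monic_multiset_prod_of_monic _ _ fun _ _ => monic_X_sub_C _
  · rw [← natDegree_map_eq_of_injective hinj, key2, hc]
    refine (natDegree_multiset_prod_X_sub_C_eq_card _).trans (by simp)

open Polynomial in
theorem map_mk_eisenstein {A : Type*} [CommRing A] (𝔭 : Ideal A)
    (q : Polynomial A) (hqm : q.Monic) (hqe : ∀ i < q.natDegree, q.coeff i ∈ 𝔭) :
    q.map (Ideal.Quotient.mk 𝔭) = X ^ q.natDegree := by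
  ext i
  rw [coeff_map, coeff_X_pow]
  rcases lt_trichotomy i q.natDegree with h | h | h
  · rw [if_neg h.ne, Ideal.Quotient.eq_zero_iff_mem.mpr (hqe i h)]
  · rw [if_pos h, h, hqm.coeff_natDegree, map_one]
  · rw [if_neg h.ne', coeff_eq_zero_of_natDegree_lt h, map_zero]

open Polynomial in
theorem lambdaRes_coeff_zero {A : Type*} [CommRing A] [Nontrivial A] (t q : Polynomial A) :
    (lambdaRes t q).coeff 0 =
      resultant q (-t) q.natDegree t.natDegree * ((-1) ^ q.natDegree * q.coeff 0) := by
  unfold lambdaRes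
  rw [sylvesterResultant_eq, coeff_zero_eq_eval_zero, ← coe_evalRingHom, ← resultant_map_map]
  have hc : (evalRingHom (0 : A)).comp C = RingHom.id A := by ext; simp
  have h1 : (C X - t.map (C : A →+* A[X]) * X).map (evalRingHom 0) = (-t) * (X - C 0) := by
    simp [Polynomial.map_map, hc]
  rw [h1, Polynomial.map_map, hc, Polynomial.map_id]
  have := resultant_mul_right q (-t) (X - C 0) q.natDegree le_rfl
  rw [natDegree_X_sub_C, natDegree_neg, resultant_X_sub_C_right _ _ _ le_rfl,
    ← coeff_zero_eq_eval_zero] at this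
  exact this



theorem stmt9 {A : Type*} [CommRing A] (𝔭 : Ideal A) (hprime : 𝔭.IsPrime)
    (hne : 𝔭 ≠ 𝔭 ^ 2) (e : ℕ) (q t : Polynomial A)
    (hqm : q.Monic) (hqd : q.natDegree = e)
    (hqe : ∀ i < e, q.coeff i ∈ 𝔭) (hq0 : q.coeff 0 ∉ 𝔭 ^ 2)
    (ht : IsUnit (t.coeff 0)) :
    (lambdaRes t q).Monic ∧ (lambdaRes t q).natDegree = e ∧
    (∀ i < e, (lambdaRes t q).coeff i ∈ 𝔭) ∧ (lambdaRes t q).coeff 0 ∉ 𝔭 ^ 2 := by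
  subst hqd
  have : Nontrivial A := ⟨⟨0, 1, fun h => hprime.ne_top ((Ideal.eq_top_iff_one _).mpr
    (h ▸ 𝔭.zero_mem))⟩⟩
  obtain ⟨hm, hd⟩ := lambdaRes_monic t q hqm
  have hmk := map_mk_eisenstein 𝔭 q hqm hqe
  refine ⟨hm, hd, ?_, ?_⟩
  · intro i hi
    have h := lambdaRes_map (Ideal.Quotient.mk 𝔭) t q
    rw [hmk, Polynomial.map_pow, Polynomial.map_X, Polynomial.resultant_X_pow_left _ _ _
      ((lambdaRes_natDegree_aux _).trans (by simpa using Polynomial.natDegree_map_le))] at h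
    rw [← Ideal.Quotient.eq_zero_iff_mem, ← Polynomial.coeff_map, h]
    simp [Polynomial.coeff_X_pow, hi.ne]
  · rw [lambdaRes_coeff_zero]
    intro h0
    rcases Nat.eq_zero_or_pos q.natDegree with he | he
    · apply hq0
      have h1 : q.coeff 0 = 1 := by rw [← he]; exact hqm.coeff_natDegree
      simpa [he, h1] using h0
    have hr : Polynomial.resultant q (-t) q.natDegree t.natDegree
        - (-t.coeff 0) ^ q.natDegree ∈ 𝔭 := by
      rw [← Ideal.Quotient.eq_zero_iff_mem, map_sub, ← Polynomial.resultant_map_map, hmk,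
        Polynomial.resultant_X_pow_left _ _ _
          (Polynomial.natDegree_map_le.trans (Polynomial.natDegree_neg t).le)]
      simp
    have h2 : (Polynomial.resultant q (-t) q.natDegree t.natDegree
        - (-t.coeff 0) ^ q.natDegree) * ((-1) ^ q.natDegree * q.coeff 0) ∈ 𝔭 ^ 2 := by
      rw [pow_two]
      exact Ideal.mul_mem_mul hr (𝔭.mul_mem_left _ (hqe 0 he))
    have h3 := (𝔭 ^ 2).sub_mem h0 h2
    have h4 : (-t.coeff 0) ^ q.natDegree * (-1) ^ q.natDegree * q.coeff 0 ∈ 𝔭 ^ 2 := by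
      convert h3 using 1
      ring
    rw [← mul_pow] at h4
    apply hq0
    refine (Ideal.unit_mul_mem_iff_mem _ ?_).mp h4
    simpa using ht.pow _
end
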